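/- Let p be a prime and let a, b be positive integers with a < p, b < p and p−1 ≤ a+b. Then the coefficient of x^{p−1} in the polynomial x^a·(1−x)^b ∈ F_p[x] equals −a!·b!·((a+b−p+1)!)^{−1} in F_p (the F_p-beta integral formula). -/

import Mathlib

theorem ZMod.factorial_mul_factorial_of_add_eq {p : ℕ} [Fact p.Prime] {a m : ℕ}
    (h : a + m = p - 1) :
    (Nat.factorial a : ZMod p) * (Nat.factorial m : ZMod p) = (-1) ^ (m + 1) := by
  induction m generalizing a with
  | zero =>
    obtain rfl : a = p - 1 := by omega
    simp [ZMod.wilsons_lemma]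
  | succ m ih =>
    have hsucc := ih (a := a + 1) (by omega)
    have hzero : ((a + m + 2 : ℕ) : ZMod p) = 0 := by
      rw [show a + m + 2 = p by omega, ZMod.natCast_self]
    rw [Nat.factorial_succ] at hsucc ⊢
    push_cast at hsucc hzero ⊢
    rw [pow_succ, ← hsucc]
    linear_combination (Nat.factorial a : ZMod p) * (Nat.factorial m : ZMod p) * hzero

theorem Polynomial.coeff_one_sub_X_pow {R : Type*} [CommRing R] (n k : ℕ) :
    ((1 - X : Polynomial R) ^ n).coeff k = (-1) ^ k * (n.choose k : R) := by
  have h : (1 - X : Polynomial R) ^ n = ((1 + X) ^ n).comp (C (-1) * X) := by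
    simp [sub_eq_add_neg]
  rw [h, comp_C_mul_X_coeff, coeff_one_add_X_pow, mul_comm]

/-- the `F_p`-beta integral formula: the coefficient of `x^{p-1}`
in `x^a (1-x)^b ∈ F_p[x]` equals `-a! b! ((a+b-p+1)!)⁻¹`. -/
theorem stmt6 (p a b : ℕ) (hp : p.Prime) (ha0 : 0 < a) (hb0 : 0 < b)
    (ha : a < p) (hb : b < p) (hab : p - 1 ≤ a + b) :
    (Polynomial.X ^ a * (1 - Polynomial.X) ^ b : Polynomial (ZMod p)).coeff (p - 1) =
      -((Nat.factorial a : ZMod p) * (Nat.factorial b : ZMod p) *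
        ((Nat.factorial (a + b - p + 1) : ZMod p))⁻¹) := by
  have : Fact p.Prime := ⟨hp⟩
  obtain ⟨m, hm⟩ : ∃ m, a + m = p - 1 := ⟨p - 1 - a, by omega⟩
  have hmb : m ≤ b := by omega
  have hfact : Nat.factorial (a + b - p + 1) = Nat.factorial (b - m) := by
    rcases hmb.eq_or_lt with rfl | hlt
    · rw [show a + m - p + 1 = 1 by omega, Nat.sub_self, Nat.factorial_one, Nat.factorial_zero]
    · rw [show a + b - p + 1 = b - m by omega]
  have hne : (Nat.factorial (b - m) : ZMod p) ≠ 0 := by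
    rw [Ne, ZMod.natCast_eq_zero_iff, hp.dvd_factorial]
    omega
  have hchoose : (b.choose m : ZMod p) * (Nat.factorial m : ZMod p) *
      (Nat.factorial (b - m) : ZMod p) = (Nat.factorial b : ZMod p) := by
    exact_mod_cast congrArg (Nat.cast : ℕ → ZMod p) (Nat.choose_mul_factorial_mul_factorial hmb)
  rw [← hm, add_comm a m, Polynomial.coeff_X_pow_mul, Polynomial.coeff_one_sub_X_pow, hfact,
    ← hchoose]
  field_simp
  have hprod := ZMod.factorial_mul_factorial_of_add_eq hm
  rw [pow_succ] at hprod
  linear_combination (b.choose m : ZMod p) * hprod
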